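/- arXiv:1204.2230 — 2 statements merged into one kernel-verified Lean document; each statement's English description precedes it below -/
import Mathlib

section
/- Let n ≥ 2 be an integer, let ρ : ℕ → ℝ be periodic with some period p ≥ 1 and with ∑_{k=0}^{p−1} ρ(k) = 0, and let a₀, a₁, C ∈ ℝ and a sequence (d_k)_{k ∈ ℕ} of real numbers satisfy |d_k − a₀k^n − (a₁ + ρ(k))k^{n−1}| ≤ C·k^{n−2} for all k ≥ 1. Define F(t) = ∑_{k=0}^{∞} d_k e^{−tk} for real t > 0 (the series converges). Then lim_{t→0⁺} t^{n+1} F(t) = a₀·n! and lim_{t→0⁺} t^{n} ( F(t) − a₀·n!/t^{n+1} ) = a₁·(n−1)!. -/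
open scoped BigOperators

open Filter Topology

/-- The Dirichlet-type series `∑ a_k k^m e^{-tk}`. -/
noncomputable def expMoment (a : ℕ → ℝ) (m : ℕ) (t : ℝ) : ℝ :=
  ∑' k : ℕ, a k * (k : ℝ) ^ m * Real.exp (-t * k)

theorem summable_expMoment {a : ℕ → ℝ} {M : ℝ} (ha : ∀ k, |a k| ≤ M) (m : ℕ) {t : ℝ}
    (ht : 0 < t) : Summable (fun k : ℕ => a k * (k : ℝ) ^ m * Real.exp (-t * k)) := by
  refine Summable.of_norm_bounded ((Real.summable_pow_mul_exp_neg_nat_mul m ht).mul_left M) ?_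
  intro k
  rw [mul_assoc, norm_mul, Real.norm_eq_abs, Real.norm_of_nonneg (by positivity)]
  exact mul_le_mul_of_nonneg_right (ha k) (by positivity)

theorem hasDerivAt_expMoment {a : ℕ → ℝ} {M : ℝ} (ha : ∀ k, |a k| ≤ M) (m : ℕ) {t : ℝ}
    (ht : 0 < t) : HasDerivAt (expMoment a m) (-expMoment a (m + 1) t) t := by
  have key := hasDerivAt_tsum_of_isPreconnected (𝕜 := ℝ) (F := ℝ)
    (g := fun (k : ℕ) (s : ℝ) => a k * (k : ℝ) ^ m * Real.exp (-s * k))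
    (g' := fun (k : ℕ) (s : ℝ) => -(a k * (k : ℝ) ^ (m + 1) * Real.exp (-s * k)))
    (u := fun k : ℕ => M * ((k : ℝ) ^ (m + 1) * Real.exp (-(t / 2) * k)))
    (t := Set.Ioi (t / 2)) (y₀ := t) (y := t)
    ((Real.summable_pow_mul_exp_neg_nat_mul (m + 1) (half_pos ht)).mul_left M)
    isOpen_Ioi isPreconnected_Ioi ?_ ?_ (half_lt_self ht) (summable_expMoment ha m ht)
    (half_lt_self ht)
  · rwa [tsum_neg] at key
  · intro k y _
    have h : HasDerivAt (fun s : ℝ => -s * k) (-1 * k) y := (hasDerivAt_neg y).mul_const _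
    exact (h.exp.const_mul (a k * (k : ℝ) ^ m)).congr_deriv (by ring)
  · intro k y hy
    rw [norm_neg, mul_assoc, norm_mul, Real.norm_eq_abs, Real.norm_of_nonneg (by positivity)]
    have hM : 0 ≤ M := (abs_nonneg _).trans (ha k)
    have hy' : t / 2 ≤ y := le_of_lt hy
    gcongr
    exact ha k

theorem AnalyticAt.dslope_self {f : ℝ → ℝ} {x : ℝ} (hf : AnalyticAt ℝ f x) :
    AnalyticAt ℝ (dslope f x) x := by
  obtain ⟨q, hq⟩ := hf
  exact ⟨_, hq.has_fpower_series_dslope_fslope⟩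

theorem exists_abs_le_of_periodic {a : ℕ → ℝ} {p : ℕ} (hp : 1 ≤ p)
    (hper : ∀ k, a (k + p) = a k) : ∃ M, ∀ k, |a k| ≤ M := by
  refine ⟨∑ j ∈ Finset.range p, |a j|, fun k => ?_⟩
  have h : Function.Periodic a p := hper
  rw [← h.map_mod_nat k]
  exact Finset.single_le_sum (f := fun j => |a j|) (fun j _ => abs_nonneg _)
    (Finset.mem_range.2 (Nat.mod_lt _ hp))

/-- Geometric summation of a series with periodic coefficients. -/
theorem one_sub_exp_mul_expMoment_zero {a : ℕ → ℝ} {p : ℕ} (hp : 1 ≤ p)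
    (hper : ∀ k, a (k + p) = a k) {t : ℝ} (ht : 0 < t) :
    (1 - Real.exp (-t * p)) * expMoment a 0 t =
      ∑ k ∈ Finset.range p, a k * Real.exp (-t * k) := by
  obtain ⟨M, hM⟩ := exists_abs_le_of_periodic hp hper
  have h := (summable_expMoment hM 0 ht).sum_add_tsum_nat_add p
  have h2 : ∀ k : ℕ, a (k + p) * ((k + p : ℕ) : ℝ) ^ 0 * Real.exp (-t * (k + p : ℕ)) =
      Real.exp (-t * p) * (a k * (k : ℝ) ^ 0 * Real.exp (-t * k)) := by
    intro k
    rw [hper, Nat.cast_add, mul_add, Real.exp_add]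
    ring
  simp_rw [h2, tsum_mul_left] at h
  simp only [pow_zero, mul_one] at h
  simp only [expMoment, pow_zero, mul_one]
  linarith

/-- The moments of a periodic sequence have, up to an analytic function, a single polar term
whose coefficient is the average of the sequence. -/
theorem expMoment_eventually_eq_polar_add_analytic {a : ℕ → ℝ} {p : ℕ} (hp : 1 ≤ p)
    (hper : ∀ k, a (k + p) = a k) {c : ℝ} (hc : ∑ k ∈ Finset.range p, a k = p * c) (m : ℕ) :
    ∃ v : ℝ → ℝ, AnalyticAt ℝ v 0 ∧
      ∀ᶠ t in 𝓝[>] (0 : ℝ), expMoment a m t = c * m.factorial / t ^ (m + 1) + v t := by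
  have hp0 : (p : ℝ) ≠ 0 := by positivity
  induction m with
  | zero =>
    set e : ℝ → ℝ := fun t => 1 - Real.exp (-t * p) with he
    set N : ℝ → ℝ := fun t => ∑ k ∈ Finset.range p, a k * Real.exp (-t * k) with hN
    have hea : AnalyticAt ℝ e 0 := by fun_prop
    have hNa : AnalyticAt ℝ N 0 := by fun_prop
    have hu : AnalyticAt ℝ (dslope e 0) 0 := hea.dslope_self
    have hu0 : dslope e 0 0 = p := by
      rw [dslope_same]
      have h : HasDerivAt (fun s : ℝ => -s * p) (-1 * p) 0 := (hasDerivAt_neg 0).mul_const _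
      have h' : deriv e 0 = _ := (h.exp.const_sub 1).deriv
      rw [h']
      simp
    have hune : dslope e 0 0 ≠ 0 := by rwa [hu0]
    set w : ℝ → ℝ := fun t => N t / dslope e 0 t with hw
    have hwa : AnalyticAt ℝ w 0 := hNa.div hu hune
    have hw0 : w 0 = c := by
      simp only [hw, hu0, hN, neg_zero, zero_mul, Real.exp_zero, mul_one, hc]
      field_simp
    refine ⟨dslope w 0, hwa.dslope_self, ?_⟩
    filter_upwards [self_mem_nhdsWithin,
      (hu.continuousAt.eventually_ne hune).filter_mono nhdsWithin_le_nhds] with t ht hut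
    have ht0 : t ≠ 0 := ne_of_gt ht
    have h1 := one_sub_exp_mul_expMoment_zero hp hper ht
    have h2 : t * dslope e 0 t = e t := by
      simpa [he] using sub_smul_dslope e 0 t
    have h3 : t * dslope w 0 t = w t - c := by
      simpa [hw0] using sub_smul_dslope w 0 t
    have h4 : w t * dslope e 0 t = N t := div_mul_cancel₀ _ hut
    have h5 : t * expMoment a 0 t = w t := by
      apply mul_right_cancel₀ hut
      rw [h4]
      calc t * expMoment a 0 t * dslope e 0 t = (t * dslope e 0 t) * expMoment a 0 t := by ring
        _ = N t := by rw [h2]; exact h1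
    simp only [Nat.factorial_zero, Nat.cast_one, mul_one, zero_add, pow_one]
    field_simp
    linarith
  | succ m ih =>
    obtain ⟨v, hv, hev⟩ := ih
    obtain ⟨M, hM⟩ := exists_abs_le_of_periodic hp hper
    refine ⟨fun t => -deriv v t, hv.deriv.neg, ?_⟩
    filter_upwards [self_mem_nhdsWithin, eventually_eventually_nhdsWithin.2 hev,
      hv.eventually_analyticAt.filter_mono nhdsWithin_le_nhds] with t ht h1 h2
    have ht' : (0 : ℝ) < t := ht
    rw [isOpen_Ioi.nhdsWithin_eq ht] at h1
    have hd1 := (hasDerivAt_expMoment hM m ht').congr_of_eventuallyEq (EventuallyEq.symm h1)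
    have hd2 := (((hasDerivAt_pow (m + 1) t).inv (by positivity)).const_mul
      (c * m.factorial)).add h2.differentiableAt.hasDerivAt
    have hd3 := hd1.unique hd2
    rw [← neg_inj, hd3, Nat.factorial_succ]
    push_cast
    field_simp
    ring

theorem tendsto_pow_mul_expMoment_sub_polar {a : ℕ → ℝ} {p : ℕ} (hp : 1 ≤ p)
    (hper : ∀ k, a (k + p) = a k) {c : ℝ} (hc : ∑ k ∈ Finset.range p, a k = p * c) (m : ℕ)
    {n : ℕ} (hn : n ≠ 0) :
    Tendsto (fun t : ℝ => t ^ n * (expMoment a m t - c * m.factorial / t ^ (m + 1)))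
      (𝓝[>] 0) (𝓝 0) := by
  obtain ⟨v, hv, hev⟩ := expMoment_eventually_eq_polar_add_analytic hp hper hc m
  have h : Tendsto (fun t : ℝ => t ^ n * v t) (𝓝[>] 0) (𝓝 (0 ^ n * v 0)) :=
    (((continuous_pow n).continuousAt.tendsto).mul hv.continuousAt.tendsto).mono_left
      nhdsWithin_le_nhds
  rw [zero_pow hn, zero_mul] at h
  refine h.congr' ?_
  filter_upwards [hev] with t ht
  rw [ht, add_sub_cancel_left]

theorem tendsto_pow_mul_expMoment {a : ℕ → ℝ} {p : ℕ} (hp : 1 ≤ p)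
    (hper : ∀ k, a (k + p) = a k) {c : ℝ} (hc : ∑ k ∈ Finset.range p, a k = p * c) (m : ℕ) :
    Tendsto (fun t : ℝ => t ^ (m + 1) * expMoment a m t) (𝓝[>] 0) (𝓝 (c * m.factorial)) := by
  have h := (tendsto_pow_mul_expMoment_sub_polar hp hper hc m m.succ_ne_zero).add_const
    (c * m.factorial)
  rw [zero_add] at h
  refine h.congr' ?_
  filter_upwards [self_mem_nhdsWithin] with t ht
  have ht0 : t ≠ 0 := ne_of_gt ht
  rw [Nat.succ_eq_add_one]
  field_simp
  ring

theorem tendsto_pow_mul_expMoment_zero {a : ℕ → ℝ} {p : ℕ} (hp : 1 ≤ p)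
    (hper : ∀ k, a (k + p) = a k) {c : ℝ} (hc : ∑ k ∈ Finset.range p, a k = p * c) {m n : ℕ}
    (hmn : m + 1 < n) :
    Tendsto (fun t : ℝ => t ^ n * expMoment a m t) (𝓝[>] 0) (𝓝 0) := by
  have h0 : Tendsto (fun t : ℝ => t ^ (n - (m + 1))) (𝓝[>] 0) (𝓝 (0 ^ (n - (m + 1)))) :=
    ((continuous_pow _).continuousAt.tendsto).mono_left nhdsWithin_le_nhds
  rw [zero_pow (by omega)] at h0
  have h := h0.mul (tendsto_pow_mul_expMoment hp hper hc m)
  rw [zero_mul] at h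
  refine h.congr fun t => ?_
  rw [← mul_assoc, ← pow_add, Nat.sub_add_cancel hmn.le]

/-- If `d_k = a₀k^n + (a₁ + ρ(k))k^{n-1} + O(k^{n-2})` with `ρ` periodic of average
zero, then `F(t) = ∑_k d_k e^{-tk}` converges for `t > 0` and has Laurent behaviour
`F(t) = a₀ n!/t^{n+1} + a₁ (n-1)!/t^n + o(t^{-n})` as `t → 0⁺`. -/
theorem index_character_two_term_expansion
    (n : ℕ) (hn : 2 ≤ n) (p : ℕ) (hp : 1 ≤ p) (ρ : ℕ → ℝ)
    (hper : ∀ k : ℕ, ρ (k + p) = ρ k)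
    (havg : ∑ k ∈ Finset.range p, ρ k = 0)
    (a₀ a₁ C : ℝ) (d : ℕ → ℝ)
    (hd : ∀ k : ℕ, 1 ≤ k →
      |d k - a₀ * (k : ℝ) ^ n - (a₁ + ρ k) * (k : ℝ) ^ (n - 1)| ≤ C * (k : ℝ) ^ (n - 2)) :
    (∀ t : ℝ, 0 < t → Summable (fun k : ℕ => d k * Real.exp (-t * k))) ∧
    Filter.Tendsto
      (fun t : ℝ => t ^ (n + 1) * ∑' k : ℕ, d k * Real.exp (-t * k))
      (nhdsWithin 0 (Set.Ioi 0)) (nhds (a₀ * n.factorial)) ∧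
    Filter.Tendsto
      (fun t : ℝ => t ^ n *
        ((∑' k : ℕ, d k * Real.exp (-t * k)) - a₀ * n.factorial / t ^ (n + 1)))
      (nhdsWithin 0 (Set.Ioi 0)) (nhds (a₁ * (n - 1).factorial)) := by
  have h1per : ∀ k : ℕ, (fun _ : ℕ => (1 : ℝ)) (k + 1) = (fun _ : ℕ => (1 : ℝ)) k := fun _ => rfl
  have h1avg : ∑ k ∈ Finset.range 1, (fun _ : ℕ => (1 : ℝ)) k = (1 : ℕ) * (1 : ℝ) := by simp
  have h1bd : ∀ k : ℕ, |(fun _ : ℕ => (1 : ℝ)) k| ≤ 1 := fun _ => by simp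
  have hbper : ∀ k : ℕ, (fun k => a₁ + ρ k) (k + p) = (fun k => a₁ + ρ k) k := fun k => by
    simp [hper]
  have hbavg : ∑ k ∈ Finset.range p, (fun k => a₁ + ρ k) k = p * a₁ := by
    simp [Finset.sum_add_distrib, havg]
  obtain ⟨M, hM⟩ := exists_abs_le_of_periodic (a := fun k => a₁ + ρ k) hp hbper
  set E : ℕ → ℝ := fun k => d k - a₀ * (k : ℝ) ^ n - (a₁ + ρ k) * (k : ℝ) ^ (n - 1) with hE
  set K : ℝ := |C| + |E 0| with hK
  have hEbd : ∀ k : ℕ, |E k| ≤ K * ((k : ℝ) ^ (n - 2) + 1) := by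
    intro k
    rcases Nat.eq_zero_or_pos k with rfl | hk
    · have : (0 : ℝ) ≤ ((0 : ℕ) : ℝ) ^ (n - 2) := by positivity
      nlinarith [abs_nonneg C, abs_nonneg (E 0)]
    · have h := hd k hk
      have : (0 : ℝ) ≤ (k : ℝ) ^ (n - 2) := by positivity
      have : C * (k : ℝ) ^ (n - 2) ≤ |C| * (k : ℝ) ^ (n - 2) := by
        gcongr
        exact le_abs_self C
      have := abs_nonneg C
      have := mul_nonneg (abs_nonneg (E 0)) ‹(0 : ℝ) ≤ (k : ℝ) ^ (n - 2)›
      have := abs_nonneg (E 0)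
      calc |E k| ≤ C * (k : ℝ) ^ (n - 2) := h
        _ ≤ K * ((k : ℝ) ^ (n - 2) + 1) := by rw [hK]; linarith
  have hmaj : ∀ t : ℝ, 0 < t → HasSum
      (fun k : ℕ => K * ((k : ℝ) ^ (n - 2) + 1) * Real.exp (-t * k))
      (K * (expMoment (fun _ => 1) (n - 2) t + expMoment (fun _ => 1) 0 t)) := by
    intro t ht
    convert! ((summable_expMoment h1bd (n - 2) ht).hasSum.add
      (summable_expMoment h1bd 0 ht).hasSum).mul_left K using 2 with k
    ring
  have hEle : ∀ (t : ℝ) (k : ℕ), ‖E k * Real.exp (-t * k)‖ ≤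
      K * ((k : ℝ) ^ (n - 2) + 1) * Real.exp (-t * k) := by
    intro t k
    rw [norm_mul, Real.norm_eq_abs, Real.norm_of_nonneg (Real.exp_nonneg _)]
    exact mul_le_mul_of_nonneg_right (hEbd k) (Real.exp_nonneg _)
  have hEsum : ∀ t : ℝ, 0 < t → Summable (fun k : ℕ => E k * Real.exp (-t * k)) :=
    fun t ht => Summable.of_norm_bounded (hmaj t ht).summable (hEle t)
  have hF : ∀ t : ℝ, 0 < t → HasSum (fun k : ℕ => d k * Real.exp (-t * k))
      (a₀ * expMoment (fun _ => 1) n t + expMoment (fun k => a₁ + ρ k) (n - 1) t +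
        ∑' k : ℕ, E k * Real.exp (-t * k)) := by
    intro t ht
    convert! (((summable_expMoment h1bd n ht).hasSum.mul_left a₀).add
      (summable_expMoment hM (n - 1) ht).hasSum).add (hEsum t ht).hasSum using 2 with k
    simp only [hE]
    ring
  have hElim : Tendsto (fun t : ℝ => t ^ n * ∑' k : ℕ, E k * Real.exp (-t * k))
      (𝓝[>] 0) (𝓝 0) := by
    have hA : Tendsto (fun t : ℝ => t ^ n * expMoment (fun _ => 1) (n - 2) t) (𝓝[>] 0) (𝓝 0) :=
      tendsto_pow_mul_expMoment_zero (a := fun _ => 1) le_rfl h1per h1avg (by omega)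
    have hB : Tendsto (fun t : ℝ => t ^ n * expMoment (fun _ => 1) 0 t) (𝓝[>] 0) (𝓝 0) :=
      tendsto_pow_mul_expMoment_zero (a := fun _ => 1) le_rfl h1per h1avg (by omega)
    have hAB := (hA.add hB).const_mul K
    rw [add_zero, mul_zero] at hAB
    refine squeeze_zero_norm' ?_ hAB
    filter_upwards [self_mem_nhdsWithin] with t ht
    have ht' : (0 : ℝ) < t := ht
    rw [norm_mul, Real.norm_of_nonneg (by positivity)]
    calc t ^ n * ‖∑' k : ℕ, E k * Real.exp (-t * k)‖
        ≤ t ^ n * (K * (expMoment (fun _ => 1) (n - 2) t + expMoment (fun _ => 1) 0 t)) := by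
          gcongr
          exact tsum_of_norm_bounded (hmaj t ht') (hEle t)
      _ = _ := by ring
  have hsecond : Tendsto
      (fun t : ℝ => t ^ n *
        ((∑' k : ℕ, d k * Real.exp (-t * k)) - a₀ * n.factorial / t ^ (n + 1)))
      (𝓝[>] 0) (𝓝 (a₁ * (n - 1).factorial)) := by
    have hA := (tendsto_pow_mul_expMoment_sub_polar (a := fun _ => 1) le_rfl h1per h1avg n
      (n := n) (by omega)).const_mul a₀
    have hB := tendsto_pow_mul_expMoment (a := fun k => a₁ + ρ k) hp hbper hbavg (n - 1)
    rw [Nat.sub_add_cancel (by omega : 1 ≤ n)] at hB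
    have h := (hA.add hB).add hElim
    rw [mul_zero, zero_add, add_zero] at h
    refine h.congr' ?_
    filter_upwards [self_mem_nhdsWithin] with t ht
    rw [(hF t ht).tsum_eq]
    ring
  refine ⟨fun t ht => (hF t ht).summable, ?_, hsecond⟩
  have hid : Tendsto (fun t : ℝ => t) (𝓝[>] 0) (𝓝 0) := tendsto_id.mono_left nhdsWithin_le_nhds
  have h := (hid.mul hsecond).add_const (a₀ * n.factorial)
  rw [zero_mul, zero_add] at h
  refine h.congr' ?_
  filter_upwards [self_mem_nhdsWithin] with t ht
  have ht0 : t ≠ 0 := ne_of_gt ht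
  field_simp
  ring
end

section
/- Let n ≥ 1 be an integer, let α, β > 0 be real numbers, let a₀, a₁ ∈ ℝ, and let F : (0, ∞) → ℝ satisfy lim_{t→0⁺} t^{n+1} F(t) = a₀·n! and lim_{t→0⁺} t^{n} ( F(t) − a₀·n!/t^{n+1} ) = a₁·(n−1)!. Define G(t) = ((1 − e^{−αt}) / (1 − e^{−βt})) · F(t) for t > 0. Then lim_{t→0⁺} t^{n+1} G(t) = (α/β)·a₀·n! and lim_{t→0⁺} t^{n} ( G(t) − (α/β)·a₀·n!/t^{n+1} ) = (α/β)·(n−1)!·( a₁ − ((α − β)/2)·n·a₀ ). -/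
open Filter Topology in
theorem tendsto_one_sub_exp_second_order (c : ℝ) :
    Tendsto (fun t : ℝ => (1 - Real.exp (-c * t) - c * t) / t ^ 2) (𝓝[>] 0)
      (𝓝 (-(c ^ 2 / 2))) := by
  rw [tendsto_iff_norm_sub_tendsto_zero]
  have hlim : Tendsto (fun t : ℝ => |c| ^ 3 * t) (𝓝[>] 0) (𝓝 0) := by
    have h : Continuous fun t : ℝ => |c| ^ 3 * t := by fun_prop
    simpa using (h.tendsto 0).mono_left nhdsWithin_le_nhds
  have hsmall : ∀ᶠ t in 𝓝[>] (0 : ℝ), |-c * t| < 1 := by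
    have h : Continuous fun t : ℝ => |-c * t| := by fun_prop
    exact ((h.tendsto 0).mono_left nhdsWithin_le_nhds).eventually_lt_const (by simp)
  refine squeeze_zero' (Eventually.of_forall fun t => norm_nonneg _) ?_ hlim
  filter_upwards [hsmall, self_mem_nhdsWithin] with t ht htpos
  have htpos : 0 < t := htpos
  have hb := Real.exp_bound ht.le (n := 3) (by norm_num)
  norm_num [Finset.sum_range_succ, Nat.factorial] at hb
  have heq : (1 - Real.exp (-c * t) - c * t) / t ^ 2 - -(c ^ 2 / 2) =
      -(Real.exp (-(c * t)) - (1 + -(c * t) + (c * t) ^ 2 / 2)) / t ^ 2 := by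
    rw [neg_mul]
    field_simp
    ring
  rw [heq, Real.norm_eq_abs, abs_div, abs_neg, abs_of_pos (pow_pos htpos 2),
    div_le_iff₀ (pow_pos htpos 2)]
  rw [abs_of_pos htpos] at hb
  have hnonneg : 0 ≤ |c| ^ 3 * t ^ 3 := by positivity
  nlinarith

open Filter Topology in
theorem tendsto_one_sub_exp_div (c : ℝ) :
    Tendsto (fun t : ℝ => (1 - Real.exp (-c * t)) / t) (𝓝[>] 0) (𝓝 c) := by
  have hid : Tendsto (fun t : ℝ => t) (𝓝[>] 0) (𝓝 0) := nhdsWithin_le_nhds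
  have h := (hid.mul (tendsto_one_sub_exp_second_order c)).const_add c
  rw [zero_mul, add_zero] at h
  refine h.congr' ?_
  filter_upwards [self_mem_nhdsWithin] with t ht
  have ht : t ≠ 0 := ne_of_gt ht
  field_simp
  ring

theorem one_sub_exp_ne_zero {β t : ℝ} (hβ : 0 < β) (ht : 0 < t) :
    1 - Real.exp (-β * t) ≠ 0 := by
  have h : Real.exp (-β * t) < 1 :=
    Real.exp_lt_one_iff.2 (by nlinarith [mul_pos hβ ht])
  linarith

open Filter Topology in
theorem tendsto_one_sub_exp_ratio (α : ℝ) {β : ℝ} (hβ : 0 < β) :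
    Tendsto (fun t : ℝ => (1 - Real.exp (-α * t)) / (1 - Real.exp (-β * t))) (𝓝[>] 0)
      (𝓝 (α / β)) := by
  refine ((tendsto_one_sub_exp_div α).div (tendsto_one_sub_exp_div β) hβ.ne').congr' ?_
  filter_upwards [self_mem_nhdsWithin] with t ht
  exact div_div_div_cancel_right₀ (ne_of_gt ht) _ _

open Filter Topology in
theorem tendsto_one_sub_exp_ratio_sub_div (α : ℝ) {β : ℝ} (hβ : 0 < β) :
    Tendsto (fun t : ℝ =>
        ((1 - Real.exp (-α * t)) / (1 - Real.exp (-β * t)) - α / β) / t) (𝓝[>] 0)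
      (𝓝 (-(α / β * ((α - β) / 2)))) := by
  have h := (((tendsto_one_sub_exp_second_order α).const_mul β).sub
    ((tendsto_one_sub_exp_second_order β).const_mul α)).div
    ((tendsto_one_sub_exp_div β).const_mul β) (mul_ne_zero hβ.ne' hβ.ne')
  have hval : (β * -(α ^ 2 / 2) - α * -(β ^ 2 / 2)) / (β * β) =
      -(α / β * ((α - β) / 2)) := by
    field_simp
    ring
  rw [hval] at h
  refine h.congr' ?_
  filter_upwards [self_mem_nhdsWithin] with t ht
  have hexp := one_sub_exp_ne_zero hβ ht
  have ht : t ≠ 0 := ne_of_gt ht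
  simp only [Pi.div_apply]
  generalize Real.exp (-β * t) = y at hexp ⊢
  field_simp
  ring


/-- Transformation of the two leading Laurent coefficients at `t = 0` under
multiplication by `(1 − e^{−αt})/(1 − e^{−βt})`: if `F(t) ~ a₀n!/t^{n+1} +
a₁(n−1)!/tⁿ + o(t⁻ⁿ)` as `t → 0⁺`, then
`G(t) = ((1 − e^{−αt})/(1 − e^{−βt}))F(t)` satisfies
`G(t) ~ (α/β)a₀n!/t^{n+1} + (α/β)(n−1)!(a₁ − ((α−β)/2)na₀)/tⁿ + o(t⁻ⁿ)`. -/
theorem rees_deformation_laurent_coefficients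
    (n : ℕ) (hn : 1 ≤ n) (α β : ℝ) (hα : 0 < α) (hβ : 0 < β)
    (a₀ a₁ : ℝ) (F : ℝ → ℝ)
    (hF₀ : Filter.Tendsto (fun t : ℝ => t ^ (n + 1) * F t)
      (nhdsWithin 0 (Set.Ioi 0)) (nhds (a₀ * n.factorial)))
    (hF₁ : Filter.Tendsto (fun t : ℝ => t ^ n * (F t - a₀ * n.factorial / t ^ (n + 1)))
      (nhdsWithin 0 (Set.Ioi 0)) (nhds (a₁ * (n - 1).factorial))) :
    Filter.Tendsto
      (fun t : ℝ => t ^ (n + 1) *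
        ((1 - Real.exp (-α * t)) / (1 - Real.exp (-β * t)) * F t))
      (nhdsWithin 0 (Set.Ioi 0)) (nhds (α / β * a₀ * n.factorial)) ∧
    Filter.Tendsto
      (fun t : ℝ => t ^ n *
        ((1 - Real.exp (-α * t)) / (1 - Real.exp (-β * t)) * F t
          - α / β * a₀ * n.factorial / t ^ (n + 1)))
      (nhdsWithin 0 (Set.Ioi 0))
      (nhds (α / β * (n - 1).factorial * (a₁ - (α - β) / 2 * n * a₀))) := by
  have hr := tendsto_one_sub_exp_ratio α hβ
  constructor
  · rw [mul_assoc]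
    exact (hr.mul hF₀).congr fun t => by ring
  · have h := (hr.mul hF₁).add
      ((tendsto_one_sub_exp_ratio_sub_div α hβ).const_mul (a₀ * n.factorial))
    have hfac : (n.factorial : ℝ) = n * (n - 1).factorial := by
      exact_mod_cast (Nat.mul_factorial_pred (by omega)).symm
    have hval : α / β * (a₁ * (n - 1).factorial) +
        a₀ * n.factorial * -(α / β * ((α - β) / 2)) =
        α / β * (n - 1).factorial * (a₁ - (α - β) / 2 * n * a₀) := by
      rw [hfac]
      ring
    rw [hval] at h
    refine h.congr' ?_
    filter_upwards [self_mem_nhdsWithin] with t ht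
    have ht : t ≠ 0 := ne_of_gt ht
    generalize (1 - Real.exp (-α * t)) / (1 - Real.exp (-β * t)) = r
    field_simp
    ring
end
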